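/- Assume G is orderable and φ is cofinal, and define the gamma norm γ(ψ) := c₊(ψ) + c₊(ψ⁻¹). Then γ(ψ) ≥ 0 for all ψ, γ(ψ) = γ(ψ⁻¹), γ(x*y) ≤ γ(x) + γ(y) for all x, y ∈ G, and γ(φ(t)*ψ) = γ(ψ) for all t ∈ ℝ and ψ ∈ G; moreover, if the selectors are non-degenerate, then γ(ψ) = 0 implies ψ = φ(t) for some t ∈ ℝ. (The gamma pseudo-norm is a group pseudo-norm invariant under the Reeb flow, degenerate exactly along the Reeb flow; Section 3.2 and Corollary 3.7 of the paper.) -/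

import Mathlib

/-- The maximal order spectral selector `c₊`. -/
noncomputable def cplus {G : Type*} (r : G → G → Prop) (φ : ℝ → G) (ψ : G) : ℝ :=
  sInf {t : ℝ | r ψ (φ t)}

/-- The minimal order spectral selector `c₋`. -/
noncomputable def cminus {G : Type*} (r : G → G → Prop) (φ : ℝ → G) (ψ : G) : ℝ :=
  sSup {t : ℝ | r (φ t) ψ}

/-- The gamma norm `γ(ψ) = c₊(ψ) + c₊(ψ⁻¹)`. -/
noncomputable def gammaNorm {G : Type*} [Group G] (r : G → G → Prop) (φ : ℝ → G) (ψ : G) : ℝ :=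
  cplus r φ ψ + cplus r φ ψ⁻¹

section OrderSelectors

variable {G : Type*} {r : G → G → Prop} {φ : ℝ → G}

theorem le_of_rel_map
    (hφinj : Function.Injective φ)
    (hφmono : ∀ s t : ℝ, s ≤ t → r (φ s) (φ t))
    (horder : ∀ x y, r x y → r y x → x = y)
    {s t : ℝ} (h : r (φ s) (φ t)) : s ≤ t := by
  by_contra! hlt
  exact hlt.ne' (hφinj (horder _ _ h (hφmono _ _ hlt.le)))

theorem isGLB_cplus
    (htrans : ∀ x y z, r x y → r y z → r x z)
    (hφinj : Function.Injective φ)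
    (hφmono : ∀ s t : ℝ, s ≤ t → r (φ s) (φ t))
    (horder : ∀ x y, r x y → r y x → x = y)
    (hcof : ∀ ψ : G, ∃ s t : ℝ, r (φ s) ψ ∧ r ψ (φ t)) (ψ : G) :
    IsGLB {t : ℝ | r ψ (φ t)} (cplus r φ ψ) := by
  obtain ⟨s, t, hs, ht⟩ := hcof ψ
  exact isGLB_csInf ⟨t, ht⟩
    ⟨s, fun u hu => le_of_rel_map hφinj hφmono horder (htrans _ _ _ hs hu)⟩

variable [Group G]

theorem rel_mul_mul_of_biinvariant
    (htrans : ∀ x y z, r x y → r y z → r x z)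
    (hbi : ∀ a b x y, r x y → r (a * x * b) (a * y * b))
    {x x' y y' : G} (hx : r x x') (hy : r y y') : r (x * y) (x' * y') := by
  refine htrans _ (x' * y) _ ?_ ?_
  · simpa using hbi 1 y _ _ hx
  · simpa using hbi x' 1 _ _ hy

theorem rel_inv_inv_of_biinvariant
    (hbi : ∀ a b x y, r x y → r (a * x * b) (a * y * b))
    {x y : G} (h : r x y) : r y⁻¹ x⁻¹ := by
  simpa [mul_assoc] using hbi x⁻¹ y⁻¹ _ _ h

theorem map_neg_eq_inv_of_map_add (hφadd : ∀ s t : ℝ, φ (s + t) = φ s * φ t) (t : ℝ) :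
    φ (-t) = (φ t)⁻¹ := by
  have h0 : φ 0 = 1 := by simpa using hφadd 0 0
  rw [eq_inv_iff_mul_eq_one, ← hφadd, neg_add_cancel, h0]

theorem cplus_mul_le
    (htrans : ∀ x y z, r x y → r y z → r x z)
    (hbi : ∀ a b x y, r x y → r (a * x * b) (a * y * b))
    (hφadd : ∀ s t : ℝ, φ (s + t) = φ s * φ t)
    (hglb : ∀ ψ, IsGLB {t : ℝ | r ψ (φ t)} (cplus r φ ψ)) (x y : G) :
    cplus r φ (x * y) ≤ cplus r φ x + cplus r φ y := by
  have h : ∀ s t, r x (φ s) → r y (φ t) → cplus r φ (x * y) ≤ s + t := fun s t hs ht =>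
    (hglb (x * y)).1 (show r _ _ from
      (hφadd s t).symm ▸ rel_mul_mul_of_biinvariant htrans hbi hs ht)
  have hx : ∀ t, r y (φ t) → cplus r φ (x * y) - t ≤ cplus r φ x := fun t ht =>
    (hglb x).2 fun s hs => by linarith [h s t hs ht]
  have hy : cplus r φ (x * y) - cplus r φ x ≤ cplus r φ y :=
    (hglb y).2 fun t ht => by linarith [hx t ht]
  linarith

theorem cminus_eq_neg_cplus_inv
    (hbi : ∀ a b x y, r x y → r (a * x * b) (a * y * b))
    (hφadd : ∀ s t : ℝ, φ (s + t) = φ s * φ t) (ψ : G) :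
    cminus r φ ψ = -cplus r φ ψ⁻¹ := by
  rw [cplus, Real.sInf_def, neg_neg, cminus]
  congr 1
  ext t
  simp only [Set.mem_ofPred_eq, Set.mem_neg, map_neg_eq_inv_of_map_add hφadd]
  exact ⟨rel_inv_inv_of_biinvariant hbi,
    fun h => by simpa using rel_inv_inv_of_biinvariant hbi h⟩

end OrderSelectors

/-- the gamma norm is a group pseudo-norm invariant under the
Reeb flow, degenerate exactly along the Reeb flow when the selectors are
non-degenerate. -/
theorem stmt_9 {G : Type*} [Group G] (r : G → G → Prop)
    (hrefl : ∀ x, r x x)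
    (htrans : ∀ x y z, r x y → r y z → r x z)
    (hbi : ∀ a b x y, r x y → r (a * x * b) (a * y * b))
    (φ : ℝ → G)
    (hφadd : ∀ s t : ℝ, φ (s + t) = φ s * φ t)
    (hφinj : Function.Injective φ)
    (hφmono : ∀ s t : ℝ, s ≤ t → r (φ s) (φ t))
    (horder : ∀ x y, r x y → r y x → x = y)
    (hcof : ∀ ψ : G, ∃ s t : ℝ, r (φ s) ψ ∧ r ψ (φ t)) :
    (∀ ψ : G, 0 ≤ gammaNorm r φ ψ) ∧
    (∀ ψ : G, gammaNorm r φ ψ = gammaNorm r φ ψ⁻¹) ∧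
    (∀ x y : G, gammaNorm r φ (x * y) ≤ gammaNorm r φ x + gammaNorm r φ y) ∧
    (∀ (t : ℝ) (ψ : G), gammaNorm r φ (φ t * ψ) = gammaNorm r φ ψ) ∧
    ((∀ (ψ : G) (t : ℝ), cminus r φ ψ = t → cplus r φ ψ = t → ψ = φ t) →
      ∀ ψ : G, gammaNorm r φ ψ = 0 → ∃ t : ℝ, ψ = φ t) := by
  have hglb := isGLB_cplus htrans hφinj hφmono horder hcof
  have hmul := cplus_mul_le htrans hbi hφadd hglb
  have hφle : ∀ t, cplus r φ (φ t) ≤ t := fun t => (hglb (φ t)).1 (hrefl (φ t))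
  have hneg := map_neg_eq_inv_of_map_add hφadd
  have htri : ∀ x y : G, gammaNorm r φ (x * y) ≤ gammaNorm r φ x + gammaNorm r φ y := by
    intro x y
    have h := hmul y⁻¹ x⁻¹
    rw [← mul_inv_rev] at h
    unfold gammaNorm
    linarith [hmul x y]
  have hle : ∀ t ψ, gammaNorm r φ (φ t * ψ) ≤ gammaNorm r φ ψ := by
    intro t ψ
    have hzero : gammaNorm r φ (φ t) ≤ 0 := by
      unfold gammaNorm
      rw [← hneg]
      linarith [hφle t, hφle (-t)]
    linarith [htri (φ t) ψ]
  refine ⟨fun ψ => ?_, fun ψ => ?_, htri, fun t ψ => ?_, fun hnd ψ h => ?_⟩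
  · have hone : 0 ≤ cplus r φ 1 := (hglb 1).2 fun t ht => by
      refine le_of_rel_map hφinj hφmono horder ?_
      have h0 : φ 0 = 1 := by simpa using hφadd 0 0
      rwa [h0]
    have h := hmul ψ ψ⁻¹
    rw [mul_inv_cancel] at h
    exact hone.trans h
  · simp only [gammaNorm, inv_inv, add_comm]
  · refine le_antisymm (hle t ψ) ?_
    simpa [hneg] using hle (-t) (φ t * ψ)
  · refine ⟨cplus r φ ψ, hnd ψ _ ?_ rfl⟩
    rw [cminus_eq_neg_cplus_inv hbi hφadd]
    unfold gammaNorm at h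
    linarith
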